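/- arXiv:2012.02226 — 3 statements merged into one kernel-verified Lean document; each statement's English description precedes it below -/
import Mathlib

section
/- For all natural numbers k ≥ 0 and d ≥ 1, the quantity c_{k,d} satisfies the recurrence c_{k,d} = k + ∑_{i=0}^{k-1} c_{i,d-1}. -/
/-- `c k d = ∑_{h=1}^{min(k,d)} binom(k,h)`, the competitive ratio of Double
Coverage for the k-taxi problem on HSTs of depth d. -/
def ckd (k d : ℕ) : ℕ := ∑ h ∈ Finset.Icc 1 (min k d), Nat.choose k h

theorem ckd_eq_range (k d : ℕ) : ckd k d = ∑ h ∈ Finset.range d, Nat.choose k (h + 1) := by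
  have h1 : ckd k d = ∑ h ∈ Finset.Icc 1 d, Nat.choose k h := by
    unfold ckd
    apply Finset.sum_subset
    · intro x hx
      simp only [Finset.mem_Icc] at *
      omega
    · intro x hx hx'
      simp only [Finset.mem_Icc] at *
      exact Nat.choose_eq_zero_of_lt (by omega)
  rw [h1, Finset.range_eq_Ico, Finset.sum_Ico_add' (fun h => Nat.choose k h) 0 d 1]
  rfl

theorem ckd_recurrence (k d : ℕ) (hd : 1 ≤ d) :
    ckd k d = k + ∑ i ∈ Finset.range k, ckd i (d - 1) := by
  obtain ⟨d, rfl⟩ : ∃ e, d = e + 1 := ⟨d - 1, by omega⟩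
  simp only [Nat.add_sub_cancel]
  induction k with
  | zero => simp [ckd]
  | succ k ih =>
    have h : ckd (k + 1) (d + 1) = ckd k d + 1 + ckd k (d + 1) := by
      simp only [ckd_eq_range, Nat.choose_succ_succ, Finset.sum_add_distrib]
      rw [Finset.sum_range_succ' (fun h => Nat.choose k h)]
      simp
    rw [Finset.sum_range_succ, h, ih]
    omega
end

section
/- Let j, L be natural numbers with L ≥ 1, let S be a finite subset of {0, 1, …, j−1}, and let f : ℕ → ℕ be a function satisfying f(i) ≤ L − 1 for all i ∈ S. Then j + ∑_{i∈S} c_{i, f(i)} ≤ c_{j,L}. -/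
theorem ckd_sum (d j : ℕ) : j + ∑ i ∈ Finset.range j, ckd i d = ckd j (d + 1) := by
  induction j with
  | zero => simp [ckd_eq_range]
  | succ j ih =>
    have h : ckd (j + 1) (d + 1) = ckd j (d + 1) + 1 + ckd j d := by
      rw [ckd_eq_range (j + 1)]
      simp only [Nat.choose_succ_succ']
      rw [Finset.sum_add_distrib, Finset.sum_range_succ', ← ckd_eq_range, ← ckd_eq_range,
        Nat.choose_zero_right]
      omega
    rw [h, Finset.sum_range_succ, ← ih]
    omega

theorem ckd_mono (k : ℕ) {d e : ℕ} (h : d ≤ e) : ckd k d ≤ ckd k e := by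
  rw [ckd_eq_range, ckd_eq_range]
  exact Finset.sum_le_sum_of_subset (Finset.range_mono h)

theorem ckd_case2_bound (j L : ℕ) (hL : 1 ≤ L) (S : Finset ℕ)
    (hS : S ⊆ Finset.range j) (f : ℕ → ℕ) (hf : ∀ i ∈ S, f i ≤ L - 1) :
    j + ∑ i ∈ S, ckd i (f i) ≤ ckd j L := by
  obtain ⟨d, rfl⟩ : ∃ d, L = d + 1 := ⟨L - 1, by omega⟩
  rw [← ckd_sum]
  apply Nat.add_le_add_left
  calc ∑ i ∈ S, ckd i (f i) ≤ ∑ i ∈ S, ckd i d :=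
        Finset.sum_le_sum fun i hi => ckd_mono i (by simpa using hf i hi)
    _ ≤ _ := Finset.sum_le_sum_of_subset hS
end

section
/- For all natural numbers k ≥ 0, d ≥ 1 and α ≥ 1, one has k·(∑_{h=0}^{d-1} α^h) + (α−1)^{d-1} · ∑_{i=1}^{k-1} c_{i,d-1} ≥ (α−1)^{d-1} · c_{k,d}. -/
theorem ckd_rec (k e : ℕ) : ckd k (e + 1) = k + ∑ i ∈ Finset.range k, ckd i e := by
  induction k with
  | zero => simp [ckd]
  | succ k ih =>
    have h : ckd (k + 1) (e + 1) = (ckd k e + 1) + ckd k (e + 1) := by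
      simp only [ckd_eq_range, Nat.choose_succ_succ, Finset.sum_add_distrib]
      rw [Finset.sum_range_succ' (fun h => Nat.choose k h) e]
      simp
    rw [h, ih, Finset.sum_range_succ]
    ring

theorem sum_Icc_ckd (k e : ℕ) :
    ∑ i ∈ Finset.Icc 1 (k - 1), ckd i e = ∑ i ∈ Finset.range k, ckd i e := by
  apply Finset.sum_subset
  · intro x hx
    simp only [Finset.mem_Icc, Finset.mem_range] at *
    omega
  · intro x hx hx'
    simp only [Finset.mem_Icc, Finset.mem_range] at *
    have : x = 0 := by omega
    subst this
    simp [ckd]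

theorem hst_lower_bound_cost (k d α : ℕ) (hd : 1 ≤ d) (hα : 1 ≤ α) :
    (α - 1) ^ (d - 1) * ckd k d ≤
      k * (∑ h ∈ Finset.range d, α ^ h) +
        (α - 1) ^ (d - 1) * ∑ i ∈ Finset.Icc 1 (k - 1), ckd i (d - 1) := by
  obtain ⟨e, rfl⟩ : ∃ e, d = e + 1 := ⟨d - 1, by omega⟩
  rw [Nat.add_sub_cancel, sum_Icc_ckd, ckd_rec, mul_add]
  have h : (α - 1) ^ e ≤ ∑ h ∈ Finset.range (e + 1), α ^ h := by
    rw [Finset.sum_range_succ]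
    exact (Nat.pow_le_pow_left (Nat.sub_le α 1) e).trans (Nat.le_add_left _ _)
  have := Nat.mul_le_mul_left k h
  rw [mul_comm ((α - 1) ^ e) k]
  omega
end
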